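/- Let p,q ≥ 1 and let π ⪯ ρ be elements of the poset S_nc-sd(p,q) such that it is NOT the case that π lies in the unhatted copy of S_disc-nc(p,q) while ρ lies in the hatted copy. Let π′ and ρ′ denote the underlying permutations of π and ρ. Then the Möbius function of S_nc-sd(p,q) satisfies μ(π,ρ) = ∏_{U ∈ Π(π′⁻¹ρ′)} (−1)^{|U|−1} C_{|U|−1}, where the product is over the orbits U of π′⁻¹ρ′ and C_k is the k-th Catalan number. -/

import Mathlib

namespace AnnNC

/-- The orbit ("same cycle") setoid of a permutation. -/
def orbitSetoid {α : Type*} (σ : Equiv.Perm α) : Setoid α :=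
  ⟨σ.SameCycle, ⟨fun x => Equiv.Perm.SameCycle.refl σ x,
    fun h => h.symm, fun h h' => h.trans h'⟩⟩

/-- Number of orbits (cycles, counting fixed points) of a permutation. -/
noncomputable def numOrbits {α : Type*} (σ : Equiv.Perm α) : ℕ :=
  Nat.card (Quotient (orbitSetoid σ))

/-- Number of blocks of the join `Π(σ) ∨ Π(ρ)` of the orbit partitions. -/
noncomputable def numJoin {α : Type*} (σ ρ : Equiv.Perm α) : ℕ :=
  Nat.card (Quotient (orbitSetoid σ ⊔ orbitSetoid ρ))

/-- Euler characteristic `χ_ρ(π) = #(ρ) + #(π) + #(π⁻¹ρ) − n`. -/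
noncomputable def euler {α : Type*} (ρ π : Equiv.Perm α) : ℤ :=
  (numOrbits ρ : ℤ) + (numOrbits π : ℤ) + (numOrbits (π⁻¹ * ρ) : ℤ) - (Nat.card α : ℤ)

/-- `π` is noncrossing on `ρ`. -/
def IsNoncrossingOn {α : Type*} (π ρ : Equiv.Perm α) : Prop :=
  euler ρ π = 2 * (numJoin π ρ : ℤ)

/-- Euler characteristic of permutations regarded as permutations of a subset `S`
(for permutations fixing the complement of `S` pointwise). -/
noncomputable def eulerOn {α : Type*} (S : Set α) (ρ π : Equiv.Perm α) : ℤ :=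
  ((numOrbits ρ : ℤ) - (Nat.card (Sᶜ : Set α) : ℤ)) +
    ((numOrbits π : ℤ) - (Nat.card (Sᶜ : Set α) : ℤ)) +
    ((numOrbits (π⁻¹ * ρ) : ℤ) - (Nat.card (Sᶜ : Set α) : ℤ)) - (Nat.card (S : Set α) : ℤ)

/-- `π` is noncrossing on `ρ`, both regarded as permutations of the subset `S`. -/
def IsNoncrossingWithin {α : Type*} (S : Set α) (π ρ : Equiv.Perm α) : Prop :=
  eulerOn S ρ π = 2 * ((numJoin π ρ : ℤ) - (Nat.card (Sᶜ : Set α) : ℤ))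

/-- `τ_{p,q} = (1,…,p)(p+1,…,p+q)` as a permutation of `Fin (p+q)`. -/
def tauPQ (p q : ℕ) : Equiv.Perm (Fin (p + q)) :=
  Equiv.permCongr finSumFinEquiv (Equiv.sumCongr (finRotate p) (finRotate q))

/-- Disc-noncrossing permutations: noncrossing on `τ_{p,q}` and the orbit partition
refines that of `τ_{p,q}`. -/
def SDiscNC (p q : ℕ) : Set (Equiv.Perm (Fin (p + q))) :=
  {π | IsNoncrossingOn π (tauPQ p q) ∧
    ∀ x y : Fin (p + q), π.SameCycle x y → ((x : ℕ) < p ↔ (y : ℕ) < p)}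

/-- Annular-noncrossing permutations: noncrossing on `τ_{p,q}` with at least one bridge. -/
def SAnnNC (p q : ℕ) : Set (Equiv.Perm (Fin (p + q))) :=
  {π | IsNoncrossingOn π (tauPQ p q) ∧
    ∃ a b : Fin (p + q), π.SameCycle a b ∧ (a : ℕ) < p ∧ p ≤ (b : ℕ)}

/-- The set of elements lying in bridges of `σ`. -/
def BridgeSet (p q : ℕ) (σ : Equiv.Perm (Fin (p + q))) : Set (Fin (p + q)) :=
  {x | ∃ a b : Fin (p + q), σ.SameCycle x a ∧ σ.SameCycle x b ∧ (a : ℕ) < p ∧ p ≤ (b : ℕ)}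

/-- `π₀` is the permutation induced by `π` on the partition `Π(τ_{p,q})`
(the first–return map of `π` to each of the two sides). -/
def IsPiZero (p q : ℕ) (π π₀ : Equiv.Perm (Fin (p + q))) : Prop :=
  ∀ a : Fin (p + q), ∃ k : ℕ, 0 < k ∧ π₀ a = (π ^ k) a ∧
    (((a : ℕ) < p) ↔ (((π ^ k) a : ℕ) < p)) ∧
    ∀ j : ℕ, 0 < j → j < k → ¬ (((a : ℕ) < p) ↔ (((π ^ j) a : ℕ) < p))

/-- The order `π ⪯ ρ` for (unhatted) permutations: the orbit partition of `π` refines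
that of `ρ` and `π` is noncrossing on `ρ`. -/
def permLe {α : Type*} (π ρ : Equiv.Perm α) : Prop :=
  (∀ x y : α, π.SameCycle x y → ρ.SameCycle x y) ∧ IsNoncrossingOn π ρ

/-- The order relation `π ⪯ ρ̂` in `S_nc-sd(p,q)`, i.e. `Kr(ρ) ⪯ Kr(π)`. -/
def leAnnHat (p q : ℕ) (π ρ : Equiv.Perm (Fin (p + q))) : Prop :=
  permLe (ρ⁻¹ * tauPQ p q) (π⁻¹ * tauPQ p q)

/-- `σ` is the permutation induced by `π` on the subset `J` (first-return map),
extended by the identity off `J`. -/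
def IsInducedOn {α : Type*} (π σ : Equiv.Perm α) (J : Set α) : Prop :=
  (∀ a ∉ J, σ a = a) ∧
  ∀ a ∈ J, ∃ k : ℕ, 0 < k ∧ σ a = (π ^ k) a ∧ (π ^ k) a ∈ J ∧
    ∀ j : ℕ, 0 < j → j < k → (π ^ j) a ∉ J

/-- The size of an orbit of a permutation. -/
noncomputable def orbitSize {α : Type*} (σ : Equiv.Perm α) (c : Quotient (orbitSetoid σ)) : ℕ :=
  Nat.card {x : α // Quotient.mk (orbitSetoid σ) x = c}

/-- `∏_{U ∈ Π(σ)} (−1)^{|U|−1} C_{|U|−1}`. -/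
noncomputable def catProd {α : Type*} (σ : Equiv.Perm α) : ℤ :=
  ∏ᶠ c : Quotient (orbitSetoid σ),
    ((-1 : ℤ) ^ (orbitSize σ c - 1) * (catalan (orbitSize σ c - 1) : ℤ))

/-- The carrier of the poset `S_nc-sd(p,q)`: pairs (permutation, hatted?). -/
def NCSDSet (p q : ℕ) : Set (Equiv.Perm (Fin (p + q)) × Bool) :=
  {z | (z.2 = false ∧ (z.1 ∈ SDiscNC p q ∪ SAnnNC p q)) ∨ (z.2 = true ∧ z.1 ∈ SDiscNC p q)}

/-- The partial order of `S_nc-sd(p,q)`. -/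
def ncsdLe (p q : ℕ) (a b : Equiv.Perm (Fin (p + q)) × Bool) : Prop :=
  (a.2 = false ∧ b.2 = false ∧ permLe a.1 b.1) ∨
  (b.2 = true ∧ permLe (b.1⁻¹ * tauPQ p q) (a.1⁻¹ * tauPQ p q))

end AnnNC

attribute [local instance] Classical.propDecidable

namespace AnnNC

open Equiv Finset

section Orbits

variable {α : Type*}

theorem image_perm_injective (g : Perm α) :
    Function.Injective (fun s : Finset α => s.image g) :=
  Finset.image_injective g.injective

theorem orbitSetoid_inv (σ : Perm α) : orbitSetoid σ⁻¹ = orbitSetoid σ :=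
  Setoid.ext fun _ _ => Perm.sameCycle_inv

theorem pow_injOn {σ : Perm α} {x : α} {k : ℕ} (h : ∀ m, 0 < m → m < k → (σ ^ m) x ≠ x) :
    Set.InjOn (fun m => (σ ^ m) x) (range k : Finset ℕ) := by
  have aux : ∀ a b, a < b → b < k → (σ ^ a) x = (σ ^ b) x → False := by
    intro a b hab hb he
    refine h (b - a) (by omega) (by omega) ?_
    apply (σ ^ a).injective
    rw [← Perm.mul_apply, ← pow_add, Nat.add_sub_cancel' hab.le, he]
  intro a ha b hb he
  simp only [coe_range, Set.mem_Iio] at ha hb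
  rcases lt_trichotomy a b with hab | hab | hab
  · exact (aux a b hab hb he).elim
  · exact hab
  · exact (aux b a hab ha he.symm).elim

theorem pow_mul_swap_apply {w : Perm α} {n i : α} {j : ℕ}
    (h : ∀ m, 0 < m → m < j → (w ^ m) n ≠ n ∧ (w ^ m) n ≠ i) (m : ℕ) (hm : 0 < m) (hmj : m ≤ j) :
    ((w * swap i n) ^ m) i = (w ^ m) n := by
  induction m, hm using Nat.le_induction with
  | base => simp
  | succ m hm ih =>
    rw [pow_succ', Perm.mul_apply, ih (by omega), pow_succ', Perm.mul_apply, Perm.mul_apply,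
      swap_apply_of_ne_of_ne (h m hm (by omega)).2 (h m hm (by omega)).1]

theorem numOrbits_inv (σ : Perm α) : numOrbits σ⁻¹ = numOrbits σ := by
  rw [numOrbits, numOrbits, orbitSetoid_inv]

variable [Fintype α]

/-- The orbit of `x` under `σ`, as a finset. -/
noncomputable def orb (σ : Perm α) (x : α) : Finset α := univ.filter (σ.SameCycle x)

/-- The finset of orbits of `σ`. -/
noncomputable def orbs (σ : Perm α) : Finset (Finset α) := univ.image (orb σ)

theorem mem_orb {σ : Perm α} {x y : α} : y ∈ orb σ x ↔ σ.SameCycle x y := by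
  simp [orb]

theorem orb_eq_iff {σ : Perm α} {x y : α} : orb σ x = orb σ y ↔ σ.SameCycle x y := by
  constructor
  · intro h
    have : y ∈ orb σ y := mem_orb.2 (Perm.SameCycle.refl _ _)
    rw [← h] at this
    exact mem_orb.1 this
  · intro h
    ext z
    rw [mem_orb, mem_orb]
    exact ⟨fun h' => h.symm.trans h', fun h' => h.trans h'⟩

/-- Orbits as elements of a quotient correspond to orbits as finsets. -/
noncomputable def quotientEquivOrbs (σ : Perm α) : Quotient (orbitSetoid σ) ≃ orbs σ :=
  Equiv.ofBijective
    (fun c => Quotient.liftOn c (fun x => (⟨orb σ x, mem_image_of_mem _ (mem_univ x)⟩ : orbs σ))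
      (fun _ _ h => Subtype.ext (orb_eq_iff.2 h)))
    (by
      constructor
      · rintro ⟨x⟩ ⟨y⟩ h
        exact Quotient.sound (orb_eq_iff.1 (congrArg Subtype.val h))
      · rintro ⟨s, hs⟩
        obtain ⟨x, -, rfl⟩ := mem_image.1 hs
        exact ⟨Quotient.mk _ x, rfl⟩)

theorem numOrbits_eq (σ : Perm α) : numOrbits σ = #(orbs σ) := by
  rw [numOrbits, Nat.card_congr (quotientEquivOrbs σ)]
  simp

/-- The Möbius invariant of the lattice of noncrossing partitions of a set of size `k`. -/
def signedCatalan (k : ℕ) : ℤ := (-1 : ℤ) ^ (k - 1) * (catalan (k - 1) : ℤ)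

theorem orbitSize_eq (σ : Perm α) (c : Quotient (orbitSetoid σ)) :
    orbitSize σ c = #(quotientEquivOrbs σ c : Finset α) := by
  induction c using Quotient.inductionOn with
  | h x =>
    have : (quotientEquivOrbs σ (Quotient.mk _ x) : Finset α) = orb σ x := rfl
    rw [this, orbitSize, orb, ← Fintype.card_subtype, ← Nat.card_eq_fintype_card]
    refine Nat.card_congr (Equiv.subtypeEquivRight fun y => ?_)
    exact Quotient.eq.trans Perm.sameCycle_comm

theorem catProd_eq (σ : Perm α) : catProd σ = ∏ s ∈ orbs σ, signedCatalan #s := by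
  have : Fintype (Quotient (orbitSetoid σ)) := Fintype.ofFinite _
  rw [catProd, finprod_eq_prod_of_fintype,
    ← prod_coe_sort (orbs σ) fun s => signedCatalan #s]
  refine Fintype.prod_equiv (quotientEquivOrbs σ) _ _ fun c => ?_
  rw [orbitSize_eq, signedCatalan]

theorem orbs_conj (g σ : Perm α) :
    orbs (g * σ * g⁻¹) = (orbs σ).image (fun s => s.image g) := by
  have key : ∀ x, orb (g * σ * g⁻¹) (g x) = (orb σ x).image g := by
    intro x
    ext y
    simp only [mem_orb, mem_image, Perm.sameCycle_conj]
    constructor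
    · intro h
      exact ⟨g⁻¹ y, by simpa using h, by simp⟩
    · rintro ⟨z, hz, rfl⟩
      simpa using hz
  ext s
  simp only [orbs, mem_image, mem_univ, true_and, exists_exists_eq_and]
  constructor
  · rintro ⟨x, rfl⟩
    exact ⟨g⁻¹ x, by rw [← key]; simp⟩
  · rintro ⟨x, rfl⟩
    exact ⟨g x, key x⟩

theorem numOrbits_mul_comm (a b : Perm α) : numOrbits (a * b) = numOrbits (b * a) := by
  have : a * b = a * (b * a) * a⁻¹ := by group
  rw [this, numOrbits_eq, numOrbits_eq, orbs_conj,
    card_image_of_injective _ (image_perm_injective a)]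

theorem catProd_mul_comm (a b : Perm α) : catProd (a * b) = catProd (b * a) := by
  have : a * b = a * (b * a) * a⁻¹ := by group
  rw [this, catProd_eq, catProd_eq, orbs_conj, prod_image (image_perm_injective a).injOn]
  refine prod_congr rfl fun s _ => ?_
  rw [card_image_of_injective _ a.injective]

/-- If the first return of `x` under `σ` is after `k` steps, its orbit has the elements
`x, σ x, …, σ^(k-1) x`. -/
theorem orb_eq_image {σ : Perm α} {x : α} {k : ℕ} (hk : 0 < k) (hx : (σ ^ k) x = x) :
    orb σ x = (range k).image (fun m => (σ ^ m) x) := by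
  ext y
  simp only [mem_orb, mem_image, mem_range]
  constructor
  · intro h
    obtain ⟨m, -, rfl⟩ := h.exists_pow_eq'
    refine ⟨m % k, Nat.mod_lt _ hk, ?_⟩
    conv_rhs => rw [← Nat.mod_add_div m k, pow_add, Perm.mul_apply, pow_mul]
    congr 1
    exact (Function.IsFixedPt.perm_pow (e := σ ^ k) hx _).symm
  · rintro ⟨m, -, rfl⟩
    exact ⟨m, by simp⟩

theorem card_orb {σ : Perm α} {x : α} {k : ℕ} (hk : 0 < k) (hx : (σ ^ k) x = x)
    (h : ∀ m, 0 < m → m < k → (σ ^ m) x ≠ x) : #(orb σ x) = k := by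
  rw [orb_eq_image hk hx, card_image_of_injOn (pow_injOn h), card_range]

/-- Every point has a first return time. -/
theorem exists_period (σ : Perm α) (x : α) :
    ∃ k, 0 < k ∧ (σ ^ k) x = x ∧ ∀ m, 0 < m → m < k → (σ ^ m) x ≠ x := by
  have hex : ∃ k, 0 < k ∧ (σ ^ k) x = x :=
    ⟨orderOf σ, orderOf_pos σ, by rw [pow_orderOf_eq_one]; rfl⟩
  refine ⟨Nat.find hex, (Nat.find_spec hex).1, (Nat.find_spec hex).2, fun m hm hlt he => ?_⟩
  exact Nat.find_min hex hlt ⟨hm, he⟩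

theorem orb_mul_swap_of_not_sameCycle {w : Perm α} {n i x : α} (hn : ¬ w.SameCycle n x)
    (hi : ¬ w.SameCycle i x) : orb (w * swap i n) x = orb w x := by
  have aux : ∀ m, ((w * swap i n) ^ m) x = (w ^ m) x := by
    intro m
    induction m with
    | zero => rfl
    | succ m ih =>
      rw [pow_succ', Perm.mul_apply, ih, pow_succ', Perm.mul_apply, Perm.mul_apply,
        swap_apply_of_ne_of_ne]
      · rintro rfl
        exact hi (Perm.SameCycle.symm ⟨m, by simp⟩)
      · rintro rfl
        exact hn (Perm.SameCycle.symm ⟨m, by simp⟩)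
  ext y
  rw [mem_orb, mem_orb]
  constructor
  · intro h
    obtain ⟨m, -, rfl⟩ := h.exists_pow_eq'
    exact ⟨m, by simp [aux]⟩
  · intro h
    obtain ⟨m, -, rfl⟩ := h.exists_pow_eq'
    exact ⟨m, by simp [aux]⟩

/-- Multiplying by a transposition of two points of one orbit splits this orbit in two. -/
theorem orbs_mul_swap {w : Perm α} {n i : α} {j k : ℕ} (hj : 0 < j) (hjk : j < k)
    (hk : (w ^ k) n = n) (h : ∀ m, 0 < m → m < k → (w ^ m) n ≠ n) (hi : (w ^ j) n = i) :
    ∃ A B : Finset α, #A = j ∧ #B = k - j ∧ A ≠ B ∧ A ∉ (orbs w).erase (orb w n) ∧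
      B ∉ (orbs w).erase (orb w n) ∧
      orbs (w * swap i n) = insert A (insert B ((orbs w).erase (orb w n))) := by
  have hinj := pow_injOn h
  have hni : w.SameCycle n i := ⟨j, by simpa using hi⟩
  have hpow : ∀ m, (w ^ m) i = (w ^ (m + j)) n := fun m => by
    rw [pow_add, Perm.mul_apply, hi]
  have hA := pow_mul_swap_apply (w := w) (n := n) (i := i) (j := j) fun m hm hmj =>
    ⟨h m hm (by omega), fun e => by
      have := hinj (x₁ := m) (x₂ := j) (by simp; omega) (by simp; omega) (e.trans hi.symm)
      omega⟩
  have hB := pow_mul_swap_apply (w := w) (n := i) (i := n) (j := k - j) fun m hm hmj =>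
    ⟨fun e => by
      rw [hpow, ← hi] at e
      have := hinj (x₁ := m + j) (x₂ := j) (by simp; omega) (by simp; omega) e
      omega, fun e => h (m + j) (by omega) (by omega) (by rw [← hpow, e])⟩
  rw [swap_comm n i] at hB
  set w' := w * swap i n with hw'
  have hAj : (w' ^ j) i = i := by rw [hA j hj le_rfl, hi]
  have hBj : (w' ^ (k - j)) n = n := by
    rw [hB _ (by omega) le_rfl, hpow, Nat.sub_add_cancel hjk.le, hk]
  have hAB : ¬ w'.SameCycle i n := by
    rw [← mem_orb, orb_eq_image hj hAj]
    simp only [mem_image, mem_range, not_exists, not_and]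
    intro m hm e
    rcases Nat.eq_zero_or_pos m with rfl | hm0
    · exact h j hj hjk (hi.trans e)
    · rw [hA m hm0 hm.le] at e
      exact h m hm0 (by omega) e
  have hnot : ∀ x, w.SameCycle n x → ∀ v : Perm α, x ∈ orb v x →
      orb v x ∉ (orbs w).erase (orb w n) := by
    intro x hx v hxv hmem
    rw [mem_erase] at hmem
    obtain ⟨y, -, hy⟩ := mem_image.1 hmem.2
    rw [← hy, mem_orb] at hxv
    exact hmem.1 (hy.symm.trans (orb_eq_iff.2 (hxv.trans hx.symm)))
  refine ⟨orb w' i, orb w' n, ?_, ?_, fun e => hAB (orb_eq_iff.1 e), ?_, ?_, ?_⟩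
  · refine card_orb hj hAj fun m hm hmj e => ?_
    rw [hA m hm hmj.le] at e
    have := hinj (x₁ := m) (x₂ := j) (by simp; omega) (by simp; omega) (e.trans hi.symm)
    omega
  · refine card_orb (by omega) hBj fun m hm hmj e => ?_
    rw [hB m hm hmj.le, hpow] at e
    exact h _ (by omega) (by omega) e
  · exact hnot i hni _ (mem_orb.2 (Perm.SameCycle.refl _ _))
  · exact hnot n (Perm.SameCycle.refl _ _) _ (mem_orb.2 (Perm.SameCycle.refl _ _))
  · have hin : ∀ x, w.SameCycle n x → orb w' x = orb w' i ∨ orb w' x = orb w' n := by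
      intro x hx
      rw [← mem_orb, orb_eq_image (by omega) hk] at hx
      obtain ⟨m, hm, rfl⟩ := mem_image.1 hx
      rw [mem_range] at hm
      rcases Nat.eq_zero_or_pos m with rfl | hm0
      · right; rfl
      · rcases le_or_gt m j with hmj | hmj
        · left
          rw [orb_eq_iff]
          exact Perm.SameCycle.symm ⟨m, by simpa using hA m hm0 hmj⟩
        · right
          rw [orb_eq_iff]
          refine Perm.SameCycle.symm ⟨(m - j : ℕ), ?_⟩
          rw [zpow_natCast, hB _ (by omega) (by omega), hpow, Nat.sub_add_cancel hmj.le]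
    have hout : ∀ x, ¬ w.SameCycle n x → orb w' x = orb w x := fun x hx =>
      orb_mul_swap_of_not_sameCycle hx fun e => hx (hni.trans e)
    ext s
    simp only [mem_insert, mem_erase]
    constructor
    · intro hs
      obtain ⟨x, -, rfl⟩ := mem_image.1 hs
      by_cases hx : w.SameCycle n x
      · rcases hin x hx with e | e <;> simp [e]
      · right; right
        rw [hout x hx]
        exact ⟨fun e => hx (orb_eq_iff.1 e).symm, mem_image_of_mem _ (mem_univ _)⟩
    · rintro (rfl | rfl | ⟨hne, hs⟩)
      · exact mem_image_of_mem _ (mem_univ _)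
      · exact mem_image_of_mem _ (mem_univ _)
      · obtain ⟨x, -, rfl⟩ := mem_image.1 hs
        rw [← hout x fun e => hne (orb_eq_iff.2 e.symm)]
        exact mem_image_of_mem _ (mem_univ _)

theorem prod_orbs_mul_swap {M : Type*} [CommMonoid M] (g : ℕ → M) {w : Perm α} {n i : α} {j k : ℕ}
    (hj : 0 < j) (hjk : j < k) (hk : (w ^ k) n = n) (h : ∀ m, 0 < m → m < k → (w ^ m) n ≠ n)
    (hi : (w ^ j) n = i) :
    ∏ s ∈ orbs (w * swap i n), g #s =
      g j * g (k - j) * ∏ s ∈ (orbs w).erase (orb w n), g #s := by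
  obtain ⟨A, B, rfl, hB, hAB, hA', hB', e⟩ := orbs_mul_swap hj hjk hk h hi
  rw [e, prod_insert (by simp [hAB, hA']), prod_insert hB', hB, mul_assoc]

theorem prod_orbs_eq {M : Type*} [CommMonoid M] (g : ℕ → M) (w : Perm α) (n : α) :
    ∏ s ∈ orbs w, g #s = g #(orb w n) * ∏ s ∈ (orbs w).erase (orb w n), g #s :=
  (mul_prod_erase _ _ (mem_image_of_mem _ (mem_univ _))).symm

theorem numOrbits_mul_swap {w : Perm α} {n i : α} (hne : i ≠ n) (h : w.SameCycle n i) :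
    numOrbits (w * swap i n) = numOrbits w + 1 := by
  obtain ⟨k, hk0, hk, hmin⟩ := exists_period w n
  have hi := mem_orb.2 h
  rw [orb_eq_image hk0 hk] at hi
  obtain ⟨j, hj, hji⟩ := mem_image.1 hi
  rw [mem_range] at hj
  have hj0 : 0 < j := Nat.pos_of_ne_zero fun e => hne (by subst e; exact hji.symm)
  obtain ⟨A, B, -, -, hAB, hA', hB', e⟩ := orbs_mul_swap hj0 hj hk hmin hji
  rw [numOrbits_eq, numOrbits_eq, e, card_insert_of_notMem (by simp [hAB, hA']),
    card_insert_of_notMem hB', card_erase_add_one]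
  exact mem_image_of_mem _ (mem_univ _)

theorem sameCycle_mul_swap {w : Perm α} {n i : α} (h : ¬ w.SameCycle n i) :
    (w * swap i n).SameCycle n i := by
  obtain ⟨k, hk0, hk, hmin⟩ := exists_period w n
  have := pow_mul_swap_apply (w := w) (n := n) (i := i) (j := k) (fun m hm hmk =>
    ⟨hmin m hm hmk, fun e => h ⟨m, by simpa using e⟩⟩) k hk0 le_rfl
  exact Perm.SameCycle.symm ⟨k, by simpa using this.trans hk⟩

theorem SameCycle.mul_swap {w : Perm α} {n i x y : α} (h : ¬ w.SameCycle n i)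
    (hxy : w.SameCycle x y) : (w * swap i n).SameCycle x y := by
  have hni := sameCycle_mul_swap h
  have step : ∀ x, (w * swap i n).SameCycle x (w x) := by
    intro x
    by_cases hx : x = i
    · subst hx
      have : (w * swap x n).SameCycle n (w x) := ⟨1, by simp⟩
      exact hni.symm.trans this
    · by_cases hx' : x = n
      · subst hx'
        have : (w * swap i x).SameCycle i (w x) := ⟨1, by simp⟩
        exact hni.trans this
      · exact ⟨1, by simp [swap_apply_of_ne_of_ne hx hx']⟩
  obtain ⟨m, -, rfl⟩ := hxy.exists_pow_eq'
  induction m with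
  | zero => exact Perm.SameCycle.refl _ _
  | succ m ih =>
    rw [pow_succ', Perm.mul_apply]
    exact (ih ⟨m, by simp⟩).trans (step _)

end Orbits

section AbsoluteOrder

variable {α : Type*}

/-- The reflection length of a permutation: `n` minus the number of its orbits. -/
noncomputable def len (σ : Perm α) : ℤ := (Nat.card α : ℤ) - numOrbits σ

theorem len_one : len (1 : Perm α) = 0 := by
  have : numOrbits (1 : Perm α) = Nat.card α := by
    refine (Nat.card_congr (Equiv.ofBijective (Quotient.mk _) ⟨?_, Quotient.mk_surjective⟩)).symm
    intro x y h
    exact Perm.sameCycle_one.1 (Quotient.exact h)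
  rw [len, this, sub_self]

theorem len_inv (σ : Perm α) : len σ⁻¹ = len σ := by rw [len, len, numOrbits_inv]

/-- The absolute order on permutations. -/
def AbsLe (a b : Perm α) : Prop := len a + len (a⁻¹ * b) = len b

theorem absLe_refl (a : Perm α) : AbsLe a a := by simp [AbsLe, len_one]

theorem len_swap_mul (w : Perm α) (n i : α) : len (swap i n * w) = len (w⁻¹ * swap i n) := by
  rw [← len_inv, mul_inv_rev, swap_inv]

variable [Fintype α]

theorem len_mul_comm (a b : Perm α) : len (a * b) = len (b * a) := by
  rw [len, len, numOrbits_mul_comm]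

theorem len_nonneg (σ : Perm α) : 0 ≤ len σ := by
  have : numOrbits σ ≤ Nat.card α := Nat.card_le_card_of_surjective _ Quotient.mk_surjective
  rw [len]
  omega

theorem len_mul_swap_of_sameCycle {w : Perm α} {n i : α} (hne : i ≠ n) (h : w.SameCycle n i) :
    len (w * swap i n) = len w - 1 := by
  rw [len, len, numOrbits_mul_swap hne h]
  push_cast
  ring

theorem len_mul_swap_of_not_sameCycle {w : Perm α} {n i : α} (h : ¬ w.SameCycle n i) :
    len (w * swap i n) = len w + 1 := by
  have hne : i ≠ n := by
    rintro rfl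
    exact h (Perm.SameCycle.refl _ _)
  have := len_mul_swap_of_sameCycle hne (sameCycle_mul_swap h)
  rw [mul_assoc, swap_mul_self, mul_one] at this
  omega

theorem len_mul_swap_le (w : Perm α) {n i : α} (hne : i ≠ n) : len (w * swap i n) ≤ len w + 1 := by
  by_cases h : w.SameCycle n i
  · rw [len_mul_swap_of_sameCycle hne h]
    omega
  · exact (len_mul_swap_of_not_sameCycle h).le

theorem len_swap_mul_of_sameCycle {w : Perm α} {n i : α} (hne : i ≠ n) (h : w.SameCycle n i) :
    len (swap i n * w) = len w - 1 := by
  rw [len_swap_mul, len_mul_swap_of_sameCycle hne (Perm.sameCycle_inv.2 h), len_inv]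

theorem len_swap_mul_of_not_sameCycle {w : Perm α} {n i : α} (h : ¬ w.SameCycle n i) :
    len (swap i n * w) = len w + 1 := by
  rw [len_swap_mul, len_mul_swap_of_not_sameCycle (fun e => h (Perm.sameCycle_inv.1 e)), len_inv]

/-- Every permutation is a product of `len` transpositions. -/
theorem len_induction {P : Perm α → Prop} (one : P 1)
    (mul_swap : ∀ (z : Perm α) (n i : α), i ≠ n → ¬ z.SameCycle n i → P z → P (z * swap i n))
    (z : Perm α) : P z := by
  obtain ⟨m, hm⟩ : ∃ m : ℕ, len z = m := ⟨(len z).toNat, (Int.toNat_of_nonneg (len_nonneg z)).symm⟩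
  induction m using Nat.strong_induction_on generalizing z with
  | _ m ih =>
    by_cases hz : z = 1
    · exact hz ▸ one
    · obtain ⟨n, hn⟩ : ∃ n, z n ≠ n := by
        by_contra! hcon
        exact hz (Perm.ext hcon)
      have hs : z.SameCycle n (z n) := ⟨1, by simp⟩
      have hlen := len_mul_swap_of_sameCycle hn hs
      have hnot : ¬ (z * swap (z n) n).SameCycle n (z n) := fun hcon => by
        have := len_mul_swap_of_sameCycle hn hcon
        rw [mul_assoc, swap_mul_self, mul_one] at this
        omega
      have := mul_swap _ n (z n) hn hnot
        (ih (m - 1) (by have := len_nonneg (z * swap (z n) n); omega) _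
          (by have := len_nonneg (z * swap (z n) n); omega))
      rwa [mul_assoc, swap_mul_self, mul_one] at this

theorem len_mul_le (a z : Perm α) : len (a * z) ≤ len a + len z := by
  induction z using len_induction with
  | one => simp [len_one]
  | mul_swap z n i hne h ih =>
    rw [len_mul_swap_of_not_sameCycle h, ← mul_assoc]
    have := len_mul_swap_le (a * z) hne
    omega

theorem len_le_add (a b : Perm α) : len b ≤ len a + len (a⁻¹ * b) := by
  simpa using len_mul_le a (a⁻¹ * b)

theorem eq_one_of_len_eq_zero {z : Perm α} (h : len z = 0) : z = 1 := by
  refine Perm.ext fun n => by_contra fun hn => ?_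
  rw [Perm.one_apply] at hn
  have := len_mul_swap_of_sameCycle hn (⟨1, by simp⟩ : z.SameCycle n (z n))
  have := len_nonneg (z * swap (z n) n)
  omega

theorem len_mul_swap_of_geodesic {a z : Perm α} {n i : α} (hne : i ≠ n) (h : ¬ z.SameCycle n i)
    (hg : len a + len (z * swap i n) = len (a * (z * swap i n))) :
    len a + len z = len (a * z) ∧ ¬ (a * z).SameCycle n i := by
  rw [len_mul_swap_of_not_sameCycle h, ← mul_assoc] at hg
  have h1 := len_mul_swap_le (a * z) hne
  have h2 := len_mul_le a z
  refine ⟨by omega, fun hcon => ?_⟩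
  have := len_mul_swap_of_sameCycle hne hcon
  omega

theorem sameCycle_mul_of_geodesic {a z : Perm α} (hg : len a + len z = len (a * z)) {x y : α}
    (hxy : a.SameCycle x y) : (a * z).SameCycle x y := by
  induction z using len_induction with
  | one => simpa using hxy
  | mul_swap z n i hne h ih =>
    obtain ⟨h1, h2⟩ := len_mul_swap_of_geodesic hne h hg
    rw [← mul_assoc]
    exact SameCycle.mul_swap h2 (ih h1)

theorem AbsLe.sameCycle {a b : Perm α} (h : AbsLe a b) {x y : α} (hxy : a.SameCycle x y) :
    b.SameCycle x y := by
  have := sameCycle_mul_of_geodesic (z := a⁻¹ * b) (by simpa [AbsLe] using h) hxy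
  simpa using this

theorem permLe_iff_absLe {a b : Perm α} : permLe a b ↔ AbsLe a b := by
  have key : (∀ x y, a.SameCycle x y → b.SameCycle x y) →
      (IsNoncrossingOn a b ↔ AbsLe a b) := by
    intro h
    have : orbitSetoid a ⊔ orbitSetoid b = orbitSetoid b := sup_eq_right.2 fun {x y} => h x y
    rw [IsNoncrossingOn, AbsLe, euler, numJoin, this, len, len, len]
    change _ = 2 * (numOrbits b : ℤ) ↔ _
    constructor <;> intro h <;> omega
  constructor
  · exact fun h => (key h.1).1 h.2
  · intro h
    have h' : ∀ x y, a.SameCycle x y → b.SameCycle x y := fun _ _ => h.sameCycle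
    exact ⟨h', (key h').2 h⟩

/-- The interval `[a, b]` of the absolute order. -/
noncomputable def absIcc (a b : Perm α) : Finset (Perm α) :=
  univ.filter fun c => AbsLe a c ∧ AbsLe c b

theorem mem_absIcc {a b c : Perm α} : c ∈ absIcc a b ↔ AbsLe a c ∧ AbsLe c b := by simp [absIcc]

theorem absLe_mul_iff {a b y : Perm α} (h : AbsLe a b) :
    AbsLe a (a * y) ∧ AbsLe (a * y) b ↔ AbsLe y (a⁻¹ * b) := by
  have h1 := len_mul_le a y
  have h2 := len_le_add y (a⁻¹ * b)
  have h3 := len_le_add (a * y) b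
  simp only [AbsLe, mul_inv_rev, mul_assoc, inv_mul_cancel_left] at *
  omega

end AbsoluteOrder

section CatalanProduct

variable {α : Type*} [Fintype α]

theorem catProd_one : catProd (1 : Perm α) = 1 := by
  rw [catProd_eq]
  refine prod_eq_one fun s hs => ?_
  obtain ⟨x, -, rfl⟩ := mem_image.1 hs
  rw [card_orb (k := 1) one_pos (by simp) (fun m hm hm' => by omega)]
  simp [signedCatalan]

theorem sum_signedCatalan_mul (m : ℕ) :
    ∑ j ∈ range (m + 1), signedCatalan (j + 1) * signedCatalan (m + 2 - (j + 1)) =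
      -signedCatalan (m + 2) := by
  have h : ∀ j ∈ range (m + 1), signedCatalan (j + 1) * signedCatalan (m + 2 - (j + 1)) =
      (-1) ^ m * ((catalan j * catalan (m - j) : ℕ) : ℤ) := by
    intro j hj
    rw [mem_range] at hj
    have e : m + 2 - (j + 1) - 1 = m - j := by omega
    have e' : (-1 : ℤ) ^ m = (-1) ^ j * (-1) ^ (m - j) := by rw [← pow_add]; congr 1; omega
    rw [signedCatalan, signedCatalan, e, Nat.add_sub_cancel, e']
    push_cast
    ring
  rw [sum_congr rfl h, ← mul_sum, ← Nat.cast_sum, signedCatalan,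
    show m + 2 - 1 = m + 1 by omega, catalan_succ,
    Fin.sum_univ_eq_sum_range (fun j => catalan j * catalan (m - j))]
  ring

/-- The Catalan recursion, as an identity between products over orbits. -/
theorem sum_catProd_mul_swap {w : Perm α} {n : α} (hn : w n ≠ n) :
    ∑ i ∈ (orb w n).erase n, catProd (w * swap i n) = -catProd w := by
  obtain ⟨k, hk0, hk, hmin⟩ := exists_period w n
  obtain ⟨m, rfl⟩ : ∃ m, k = m + 2 := by
    refine ⟨k - 2, ?_⟩
    have : k ≠ 1 := by
      rintro rfl
      exact hn hk
    omega
  have hinj := pow_injOn hmin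
  have herase : (orb w n).erase n = (range (m + 1)).image fun j => (w ^ (j + 1)) n := by
    rw [orb_eq_image hk0 hk]
    ext x
    simp only [mem_erase, mem_image, mem_range]
    constructor
    · rintro ⟨hx, j, hj, rfl⟩
      obtain ⟨j, rfl⟩ : ∃ j', j = j' + 1 :=
        Nat.exists_eq_succ_of_ne_zero (by rintro rfl; exact hx rfl)
      exact ⟨j, by omega, rfl⟩
    · rintro ⟨j, hj, rfl⟩
      exact ⟨hmin _ (by omega) (by omega), j + 1, by omega, rfl⟩
  rw [herase, sum_image]
  · have h : ∀ j ∈ range (m + 1), catProd (w * swap ((w ^ (j + 1)) n) n) =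
        signedCatalan (j + 1) * signedCatalan (m + 2 - (j + 1)) *
          ∏ s ∈ (orbs w).erase (orb w n), signedCatalan #s := by
      intro j hj
      rw [mem_range] at hj
      rw [catProd_eq]
      exact prod_orbs_mul_swap signedCatalan (by omega) (by omega) hk hmin rfl
    rw [sum_congr rfl h, ← sum_mul, sum_signedCatalan_mul, catProd_eq, prod_orbs_eq _ w n,
      card_orb hk0 hk hmin, neg_mul]
  · intro a ha b hb e
    have := hinj (x₁ := a + 1) (x₂ := b + 1) (by simpa using ha) (by simpa using hb) e
    omega

theorem absLe_mul_swap {w y : Perm α} {n : α} (h : AbsLe y w) (hn : (y⁻¹ * w) n ≠ n) :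
    AbsLe (y * swap ((y⁻¹ * w) n) n) w ∧ ((y * swap ((y⁻¹ * w) n) n)⁻¹ * w) n = n ∧
      (y * swap ((y⁻¹ * w) n) n).SameCycle n ((y⁻¹ * w) n) := by
  set i := (y⁻¹ * w) n with hi
  have hz := len_swap_mul_of_sameCycle hn (⟨1, by simp [hi]⟩ : (y⁻¹ * w).SameCycle n i)
  have e : (y * swap i n)⁻¹ * w = swap i n * (y⁻¹ * w) := by
    rw [mul_inv_rev, swap_inv, mul_assoc]
  have h1 := len_le_add (y * swap i n) w
  have h2 := len_mul_swap_le y hn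
  unfold AbsLe at *
  rw [e] at *
  refine ⟨by omega, by rw [Perm.mul_apply, ← hi, swap_apply_left], ?_⟩
  refine sameCycle_mul_swap fun hcon => ?_
  have := len_mul_swap_of_sameCycle hn hcon
  omega

theorem absLe_mul_swap' {w y : Perm α} {n i : α} (h : AbsLe y w) (hn : (y⁻¹ * w) n = n)
    (hne : i ≠ n) (hi : y.SameCycle n i) :
    AbsLe (y * swap i n) w ∧ ((y * swap i n)⁻¹ * w) n = i := by
  have e : (y * swap i n)⁻¹ * w = swap i n * (y⁻¹ * w) := by
    rw [mul_inv_rev, swap_inv, mul_assoc]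
  have hnot : ¬ (y⁻¹ * w).SameCycle n i := fun hcon => hne (hcon.eq_of_left hn).symm
  have h1 := len_swap_mul_of_not_sameCycle hnot
  have h2 := len_mul_swap_of_sameCycle hne hi
  unfold AbsLe at *
  rw [e]
  exact ⟨by omega, by rw [Perm.mul_apply, hn, swap_apply_right]⟩

/-- The product of signed Catalan numbers sums to zero over every nontrivial lower interval of
the absolute order. -/
theorem sum_catProd_absLe (w : Perm α) :
    ∑ y ∈ univ.filter (fun y => AbsLe y w), catProd y = if w = 1 then 1 else 0 := by
  split_ifs with hw
  · subst hw
    rw [sum_eq_single_of_mem 1 (by simp [absLe_refl]), catProd_one]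
    intro y hy hy1
    refine (hy1 (eq_one_of_len_eq_zero ?_)).elim
    have hy' : AbsLe y 1 := by simpa using hy
    have h1 := len_nonneg y
    have h2 := len_nonneg (y⁻¹ * 1)
    have h3 : len (1 : Perm α) = 0 := len_one
    unfold AbsLe at hy'
    omega
  obtain ⟨n, hn⟩ : ∃ n, w n ≠ n := by
    by_contra! hcon
    exact hw (Perm.ext hcon)
  rw [← sum_filter_add_sum_filter_not _ (fun y : Perm α => (y⁻¹ * w) n = n)]
  have hmove : ∑ y ∈ (univ.filter fun y => AbsLe y w).filter (fun y => ¬ (y⁻¹ * w) n = n),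
      catProd y = ∑ y ∈ (univ.filter fun y => AbsLe y w).filter (fun y => (y⁻¹ * w) n = n),
        ∑ i ∈ (orb y n).erase n, catProd (y * swap i n) := by
    rw [sum_sigma']
    refine sum_bij' (fun y _ => ⟨y * swap ((y⁻¹ * w) n) n, (y⁻¹ * w) n⟩)
      (fun p _ => p.1 * swap p.2 n) ?_ ?_ ?_ ?_ ?_
    · intro y hy
      simp only [mem_filter, mem_univ, true_and] at hy
      obtain ⟨h1, h2, h3⟩ := absLe_mul_swap hy.1 hy.2
      simp only [mem_sigma, mem_filter, mem_univ, true_and, mem_erase, mem_orb]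
      exact ⟨⟨h1, h2⟩, hy.2, h3⟩
    · rintro ⟨y, i⟩ hy
      simp only [mem_sigma, mem_filter, mem_univ, true_and, mem_erase, mem_orb] at hy
      obtain ⟨h1, h2⟩ := absLe_mul_swap' hy.1.1 hy.1.2 hy.2.1 hy.2.2
      simp only [mem_filter, mem_univ, true_and]
      exact ⟨h1, by rw [h2]; exact hy.2.1⟩
    · intro y _
      simp [mul_assoc]
    · rintro ⟨y, i⟩ hy
      simp only [mem_sigma, mem_filter, mem_univ, true_and, mem_erase, mem_orb] at hy
      obtain ⟨-, h2⟩ := absLe_mul_swap' hy.1.1 hy.1.2 hy.2.1 hy.2.2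
      simp only [h2]
      rw [mul_assoc, swap_mul_self, mul_one]
    · intro y _
      simp [mul_assoc]
  rw [hmove, ← sum_add_distrib]
  refine sum_eq_zero fun y hy => ?_
  simp only [mem_filter, mem_univ, true_and] at hy
  rw [sum_catProd_mul_swap, add_neg_cancel]
  intro hcon
  apply hn
  have h2 := hy.2
  rw [Perm.mul_apply, Perm.inv_eq_iff_eq] at h2
  rw [h2, hcon]

theorem sum_catProd_absIcc {a b : Perm α} (h : AbsLe a b) :
    ∑ c ∈ absIcc a b, catProd (a⁻¹ * c) = if a = b then 1 else 0 := by
  have := sum_catProd_absLe (a⁻¹ * b)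
  simp only [inv_mul_eq_one] at this
  rw [← this]
  refine sum_bij' (fun c _ => a⁻¹ * c) (fun y _ => a * y) ?_ ?_ ?_ ?_ ?_
  · intro c hc
    rw [mem_absIcc] at hc
    simp only [mem_filter, mem_univ, true_and]
    rw [← absLe_mul_iff h]
    simpa using hc
  · intro y hy
    simp only [mem_filter, mem_univ, true_and] at hy
    exact mem_absIcc.2 ((absLe_mul_iff h).2 hy)
  · simp
  · simp
  · simp

/-- The Möbius function on a lower-closed part of an upper interval of the absolute order. -/
theorem eq_catProd_of_sum_absIcc (D : Perm α → Prop) (hD : ∀ b c, D b → AbsLe c b → D c)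
    (a : Perm α) (m : Perm α → ℤ)
    (hm : ∀ b, D b → AbsLe a b → ∑ c ∈ absIcc a b, m c = if a = b then 1 else 0)
    (b : Perm α) (hb : D b) (hab : AbsLe a b) : m b = catProd (a⁻¹ * b) := by
  obtain ⟨k, hk⟩ : ∃ k : ℕ, len b = k := ⟨(len b).toNat, (Int.toNat_of_nonneg (len_nonneg b)).symm⟩
  induction k using Nat.strong_induction_on generalizing b with
  | _ k ih =>
    have hmem : b ∈ absIcc a b := mem_absIcc.2 ⟨hab, absLe_refl b⟩
    have h := (hm b hb hab).trans (sum_catProd_absIcc hab).symm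
    rw [← add_sum_erase _ _ hmem, ← add_sum_erase _ _ hmem] at h
    have hrest : ∑ c ∈ (absIcc a b).erase b, m c =
        ∑ c ∈ (absIcc a b).erase b, catProd (a⁻¹ * c) := by
      refine sum_congr rfl fun c hc => ?_
      rw [mem_erase, mem_absIcc] at hc
      obtain ⟨hcb, hac, hcb'⟩ := hc
      have hpos : 0 < len (c⁻¹ * b) := (len_nonneg _).lt_of_ne fun e =>
        hcb (inv_mul_eq_one.1 (eq_one_of_len_eq_zero e.symm))
      have h0 := len_nonneg c
      have hlen : len c + len (c⁻¹ * b) = len b := hcb'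
      exact ih (len c).toNat (by omega) c (hD b c hb hcb') hac (by omega)
    rw [hrest] at h
    exact add_right_cancel h

end CatalanProduct

section Sides

variable {α : Type*} {S : α → Prop}

/-- `σ` preserves the two sides `S` and `Sᶜ`, that is, it has no bridge. -/
def PreservesSides (S : α → Prop) (σ : Perm α) : Prop := ∀ x, S (σ x) ↔ S x

theorem PreservesSides.mul {σ ρ : Perm α} (h : PreservesSides S σ) (h' : PreservesSides S ρ) :
    PreservesSides S (σ * ρ) := fun x => (h _).trans (h' x)

theorem PreservesSides.inv {σ : Perm α} (h : PreservesSides S σ) : PreservesSides S σ⁻¹ :=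
  fun x => by rw [← h (σ⁻¹ x), ← Perm.mul_apply, mul_inv_cancel, Perm.one_apply]

theorem preservesSides_iff [Finite α] {σ : Perm α} :
    PreservesSides S σ ↔ ∀ x y, σ.SameCycle x y → (S x ↔ S y) := by
  constructor
  · intro h x y hxy
    obtain ⟨m, -, rfl⟩ := hxy.exists_pow_eq'
    clear hxy
    induction m with
    | zero => rfl
    | succ m ih => rw [pow_succ', Perm.mul_apply, h, ih]
  · exact fun h x => (h x (σ x) ⟨1, by simp⟩).symm

theorem preservesSides_swap {x y : α} (h : S x ↔ S y) : PreservesSides S (swap x y) := by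
  intro z
  rcases eq_or_ne z x with rfl | hx
  · rw [swap_apply_left, h]
  · rcases eq_or_ne z y with rfl | hy
    · rw [swap_apply_right, h]
    · rw [swap_apply_of_ne_of_ne hx hy]

theorem PreservesSides.of_absLe [Fintype α] {σ ρ : Perm α} (hρ : PreservesSides S ρ)
    (h : AbsLe σ ρ) : PreservesSides S σ :=
  preservesSides_iff.2 fun x y hxy => preservesSides_iff.1 hρ x y (h.sameCycle hxy)

theorem preservesSides_mul_iff {σ ρ : Perm α} (h : PreservesSides S σ) :
    PreservesSides S (σ * ρ) ↔ PreservesSides S ρ :=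
  ⟨fun h' => by simpa using h.inv.mul h', h.mul⟩

theorem preservesSides_mul_iff' {σ ρ : Perm α} (h : PreservesSides S ρ) :
    PreservesSides S (σ * ρ) ↔ PreservesSides S σ :=
  ⟨fun h' => by simpa using h'.mul h.inv, fun h' => h'.mul h⟩

theorem preservesSides_inv_iff {σ : Perm α} : PreservesSides S σ⁻¹ ↔ PreservesSides S σ :=
  ⟨fun h => by simpa using h.inv, PreservesSides.inv⟩

end Sides

section TwoSided

variable {α : Type*} {S : α → Prop} {τ : Perm α}

theorem numOrbits_of_sides (hτ : ∀ x y, τ.SameCycle x y ↔ (S x ↔ S y)) (hS : ∃ x, S x)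
    (hS' : ∃ x, ¬ S x) : numOrbits τ = 2 := by
  obtain ⟨a, ha⟩ := hS
  obtain ⟨b, hb⟩ := hS'
  rw [numOrbits, Nat.card_eq_two_iff]
  refine ⟨Quotient.mk _ a, Quotient.mk _ b, fun e => ?_, ?_⟩
  · exact hb (((hτ a b).1 (Quotient.exact e)).1 ha)
  · refine Set.eq_univ_of_forall fun c => ?_
    induction c using Quotient.inductionOn with
    | h x =>
      by_cases hx : S x
      · left
        exact Quotient.sound ((hτ x a).2 (by tauto))
      · right
        exact Quotient.sound ((hτ x b).2 (by tauto))

theorem preservesSides_kreweras_iff (hτ : PreservesSides S τ) {σ : Perm α} :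
    PreservesSides S (τ * σ⁻¹) ↔ PreservesSides S σ := by
  rw [preservesSides_mul_iff hτ, preservesSides_inv_iff]

theorem len_of_sides (hτ : ∀ x y, τ.SameCycle x y ↔ (S x ↔ S y)) (hS : ∃ x, S x)
    (hS' : ∃ x, ¬ S x) : len τ = Nat.card α - 2 := by
  rw [len, numOrbits_of_sides hτ hS hS']
  rfl

variable [Fintype α]

/-- `σ` is noncrossing on a permutation `τ` whose orbits are the two sides `S` and `Sᶜ`,
in terms of reflection lengths: the genus is zero, with or without a bridge. -/
def TwoSidedNC (S : α → Prop) (τ σ : Perm α) : Prop :=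
  (PreservesSides S σ ∧ len σ + len (σ⁻¹ * τ) = Nat.card α - 2) ∨
    (¬ PreservesSides S σ ∧ len σ + len (σ⁻¹ * τ) = Nat.card α)

theorem numJoin_of_preservesSides (hτ : ∀ x y, τ.SameCycle x y ↔ (S x ↔ S y)) (hS : ∃ x, S x)
    (hS' : ∃ x, ¬ S x) {σ : Perm α} (h : PreservesSides S σ) : numJoin σ τ = 2 := by
  have : orbitSetoid σ ⊔ orbitSetoid τ = orbitSetoid τ :=
    sup_eq_right.2 fun {x y} hxy => (hτ x y).2 (preservesSides_iff.1 h x y hxy)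
  rw [numJoin, this]
  exact numOrbits_of_sides hτ hS hS'

theorem numJoin_of_not_preservesSides (hτ : ∀ x y, τ.SameCycle x y ↔ (S x ↔ S y))
    {σ : Perm α} (h : ¬ PreservesSides S σ) : numJoin σ τ = 1 := by
  obtain ⟨a, ha⟩ : ∃ a, ¬ (S (σ a) ↔ S a) := by
    by_contra! hcon
    exact h hcon
  have h1 : ∀ x y, (S x ↔ S y) → (orbitSetoid σ ⊔ orbitSetoid τ) x y := fun x y hxy =>
    (le_sup_right : orbitSetoid τ ≤ orbitSetoid σ ⊔ orbitSetoid τ) ((hτ x y).2 hxy)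
  have h2 : (orbitSetoid σ ⊔ orbitSetoid τ) (σ a) a :=
    (le_sup_left : orbitSetoid σ ≤ orbitSetoid σ ⊔ orbitSetoid τ)
      (Perm.SameCycle.symm ⟨1, by simp⟩ : σ.SameCycle (σ a) a)
  have h3 : ∀ x, (orbitSetoid σ ⊔ orbitSetoid τ) x a := by
    intro x
    by_cases hx : S x ↔ S a
    · exact h1 x a hx
    · exact Setoid.trans' _ (h1 x (σ a) (by tauto)) h2
  rw [numJoin, Nat.card_eq_one_iff_unique]
  refine ⟨⟨fun c d => ?_⟩, ⟨Quotient.mk _ a⟩⟩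
  induction c, d using Quotient.inductionOn₂ with
  | h x y => exact Quotient.sound (Setoid.trans' _ (h3 x) (Setoid.symm' _ (h3 y)))

theorem isNoncrossingOn_iff (hτ : ∀ x y, τ.SameCycle x y ↔ (S x ↔ S y)) (hS : ∃ x, S x)
    (hS' : ∃ x, ¬ S x) {σ : Perm α} : IsNoncrossingOn σ τ ↔ TwoSidedNC S τ σ := by
  rw [IsNoncrossingOn, euler, numOrbits_of_sides hτ hS hS', TwoSidedNC, len, len]
  by_cases h : PreservesSides S σ
  · rw [numJoin_of_preservesSides hτ hS hS' h]
    simp only [h, true_and, not_true, false_and, or_false]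
    constructor <;> intro h <;> omega
  · rw [numJoin_of_not_preservesSides hτ h]
    simp only [h, true_and, not_false_eq_true, false_and, false_or]
    constructor <;> intro h <;> omega

theorem preservesSides_of_sides (hτ : ∀ x y, τ.SameCycle x y ↔ (S x ↔ S y)) :
    PreservesSides S τ :=
  preservesSides_iff.2 fun x y => (hτ x y).1

theorem TwoSidedNC.of_mul_swap (hτ : ∀ x y, τ.SameCycle x y ↔ (S x ↔ S y)) (hS : ∃ x, S x)
    (hS' : ∃ x, ¬ S x) {σ : Perm α} {n i : α} (hni : ¬ σ.SameCycle n i)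
    (h : TwoSidedNC S τ (σ * swap i n)) : TwoSidedNC S τ σ := by
  have hne : i ≠ n := by
    rintro rfl
    exact hni (Perm.SameCycle.refl _ _)
  have hτ' := preservesSides_of_sides hτ
  have hlen := len_of_sides hτ hS hS'
  have h1 := len_mul_swap_of_not_sameCycle hni
  have h2 := len_le_add σ τ
  have hle : AbsLe σ (σ * swap i n) := by
    have := len_mul_swap_of_not_sameCycle
      (fun e => hne (Perm.sameCycle_one.1 e).symm : ¬ (1 : Perm α).SameCycle n i)
    rw [one_mul, len_one] at this
    rw [AbsLe, inv_mul_cancel_left, this, h1]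
    ring
  unfold TwoSidedNC at h ⊢
  rw [mul_inv_rev, swap_inv, mul_assoc] at h
  have h3 : len (swap i n * (σ⁻¹ * τ)) = len (σ⁻¹ * τ) + 1 ∨
      ((σ⁻¹ * τ).SameCycle n i ∧ len (swap i n * (σ⁻¹ * τ)) = len (σ⁻¹ * τ) - 1) := by
    by_cases hx : (σ⁻¹ * τ).SameCycle n i
    · exact Or.inr ⟨hx, len_swap_mul_of_sameCycle hne hx⟩
    · exact Or.inl (len_swap_mul_of_not_sameCycle hx)
  rcases h with ⟨hp, hd⟩ | ⟨hp, hd⟩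
  · exact Or.inl ⟨hp.of_absLe hle, by rcases h3 with h3 | ⟨-, h3⟩ <;> omega⟩
  · by_cases hσ : PreservesSides S σ
    · left
      refine ⟨hσ, ?_⟩
      rcases h3 with h3 | ⟨hx, -⟩
      · omega
      · have := preservesSides_iff.1 (hσ.inv.mul hτ') _ _ hx
        exact (hp (hσ.mul (preservesSides_swap this.symm))).elim
    · right
      refine ⟨hσ, ?_⟩
      have : len σ + len (σ⁻¹ * τ) ≠ len τ := fun e => hσ (hτ'.of_absLe e)
      rcases h3 with h3 | ⟨-, h3⟩ <;> omega

/-- Noncrossing permutations are closed downwards in the absolute order. -/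
theorem TwoSidedNC.of_absLe (hτ : ∀ x y, τ.SameCycle x y ↔ (S x ↔ S y)) (hS : ∃ x, S x)
    (hS' : ∃ x, ¬ S x) {σ ρ : Perm α} (hρ : TwoSidedNC S τ ρ) (h : AbsLe σ ρ) :
    TwoSidedNC S τ σ := by
  obtain ⟨z, rfl⟩ : ∃ z, ρ = σ * z := ⟨σ⁻¹ * ρ, by simp⟩
  rw [AbsLe, inv_mul_cancel_left] at h
  induction z using len_induction with
  | one => simpa using hρ
  | mul_swap z n i hne hz ih =>
    obtain ⟨h1, h2⟩ := len_mul_swap_of_geodesic hne hz h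
    rw [← mul_assoc] at hρ
    exact ih (hρ.of_mul_swap hτ hS hS' h2) h1

theorem twoSidedNC_kreweras_iff (hτ : PreservesSides S τ) {σ : Perm α} :
    TwoSidedNC S τ (τ * σ⁻¹) ↔ TwoSidedNC S τ σ := by
  have : (τ * σ⁻¹)⁻¹ * τ = σ := by group
  rw [TwoSidedNC, preservesSides_kreweras_iff hτ, this, TwoSidedNC, len_mul_comm τ,
    add_comm (len (σ⁻¹ * τ))]

/-- The Kreweras complement reverses the order on noncrossing permutations with a bridge. -/
theorem absLe_kreweras_iff {x y : Perm α} (hx : len x + len (x⁻¹ * τ) = len y + len (y⁻¹ * τ)) :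
    AbsLe (τ * y⁻¹) (τ * x⁻¹) ↔ AbsLe x y := by
  have e : (τ * y⁻¹)⁻¹ * (τ * x⁻¹) = y * x⁻¹ := by group
  have h1 := len_mul_comm y x⁻¹
  rw [AbsLe, AbsLe, e, len_mul_comm τ, len_mul_comm τ]
  omega

end TwoSided

section Poset

theorem sameCycle_finRotate (p : ℕ) (x y : Fin p) : (finRotate p).SameCycle x y := by
  match p with
  | 0 => exact x.elim0
  | 1 => rw [Subsingleton.elim x y]
  | p + 2 =>
    have h : ∀ z, (finRotate (p + 2)) z ≠ z := fun z => by
      rw [← Perm.mem_support, support_finRotate]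
      exact mem_univ z
    exact isCycle_finRotate.sameCycle (h x) (h y)

theorem tauPQ_pow (p q m : ℕ) :
    tauPQ p q ^ m = Equiv.permCongr finSumFinEquiv
      (Equiv.sumCongr (finRotate p ^ m) (finRotate q ^ m)) := by
  induction m with
  | zero => ext x; simp [Equiv.permCongr_def]
  | succ m ih =>
    ext x
    obtain ⟨z, rfl⟩ := finSumFinEquiv.surjective x
    rw [pow_succ, ih]
    cases z <;> simp [tauPQ, pow_succ, Equiv.permCongr_def]

/-- The first of the two sides of the annulus. -/
def leftSide (p q : ℕ) (x : Fin (p + q)) : Prop := (x : ℕ) < p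

theorem sameCycle_tauPQ (p q : ℕ) (x y : Fin (p + q)) :
    (tauPQ p q).SameCycle x y ↔ (leftSide p q x ↔ leftSide p q y) := by
  obtain ⟨x, rfl⟩ := finSumFinEquiv.surjective x
  obtain ⟨y, rfl⟩ := finSumFinEquiv.surjective y
  have hpres : PreservesSides (leftSide p q) (tauPQ p q) := by
    intro z
    obtain ⟨z, rfl⟩ := finSumFinEquiv.surjective z
    cases z <;> simp [leftSide, tauPQ, Equiv.permCongr_def]
  refine ⟨preservesSides_iff.1 hpres _ _, fun h => ?_⟩
  rcases x with x | x <;> rcases y with y | y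
  · obtain ⟨m, -, rfl⟩ := (sameCycle_finRotate p x y).exists_pow_eq'
    exact ⟨m, by simp [tauPQ_pow, Equiv.permCongr_def]⟩
  · simp [leftSide] at h
  · simp [leftSide] at h
  · obtain ⟨m, -, rfl⟩ := (sameCycle_finRotate q x y).exists_pow_eq'
    exact ⟨m, by simp [tauPQ_pow, Equiv.permCongr_def]⟩

variable {p q : ℕ}

theorem exists_leftSide (hp : 1 ≤ p) : ∃ x, leftSide p q x :=
  ⟨⟨0, by omega⟩, hp⟩

theorem exists_not_leftSide (hq : 1 ≤ q) : ∃ x, ¬ leftSide p q x :=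
  ⟨⟨p, by omega⟩, lt_irrefl p⟩

theorem isNoncrossingOn_tauPQ_iff (hp : 1 ≤ p) (hq : 1 ≤ q) {σ : Perm (Fin (p + q))} :
    IsNoncrossingOn σ (tauPQ p q) ↔ TwoSidedNC (leftSide p q) (tauPQ p q) σ :=
  isNoncrossingOn_iff (sameCycle_tauPQ p q) (exists_leftSide hp) (exists_not_leftSide hq)

theorem mem_SDiscNC_iff (hp : 1 ≤ p) (hq : 1 ≤ q) {σ : Perm (Fin (p + q))} :
    σ ∈ SDiscNC p q ↔
      TwoSidedNC (leftSide p q) (tauPQ p q) σ ∧ PreservesSides (leftSide p q) σ := by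
  rw [← isNoncrossingOn_tauPQ_iff hp hq, preservesSides_iff]
  rfl

theorem mem_SAnnNC_iff (hp : 1 ≤ p) (hq : 1 ≤ q) {σ : Perm (Fin (p + q))} :
    σ ∈ SAnnNC p q ↔
      TwoSidedNC (leftSide p q) (tauPQ p q) σ ∧ ¬ PreservesSides (leftSide p q) σ := by
  rw [← isNoncrossingOn_tauPQ_iff hp hq, preservesSides_iff]
  refine and_congr_right fun _ => ⟨?_, fun h => ?_⟩
  · rintro ⟨a, b, hab, ha, hb⟩ hcon
    exact absurd ((hcon a b hab).1 ha) hb.not_gt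
  · push Not at h
    obtain ⟨x, y, hxy, h | h⟩ := h
    · exact ⟨x, y, hxy, h.1, not_lt.1 h.2⟩
    · exact ⟨y, x, hxy.symm, h.2, not_lt.1 h.1⟩

theorem mem_NCSDSet_iff (hp : 1 ≤ p) (hq : 1 ≤ q) {z : Perm (Fin (p + q)) × Bool} :
    z ∈ NCSDSet p q ↔ TwoSidedNC (leftSide p q) (tauPQ p q) z.1 ∧
      (z.2 = true → PreservesSides (leftSide p q) z.1) := by
  rcases z with ⟨σ, b⟩
  have h1 := mem_SDiscNC_iff hp hq (σ := σ)
  have h2 := mem_SAnnNC_iff hp hq (σ := σ)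
  by_cases h : PreservesSides (leftSide p q) σ <;> cases b <;>
    simp [NCSDSet, h1, h2, h]

theorem interval_unhatted (hp : 1 ≤ p) (hq : 1 ≤ q) {a b : Perm (Fin (p + q))}
    (hb : TwoSidedNC (leftSide p q) (tauPQ p q) b) :
    {c | c ∈ NCSDSet p q ∧ ncsdLe p q (a, false) c ∧ ncsdLe p q c (b, false)} =
      ((absIcc a b).image fun σ => (σ, false) : Finset _) := by
  ext ⟨σ, t⟩
  have hdown := hb.of_absLe (sameCycle_tauPQ p q) (exists_leftSide hp) (exists_not_leftSide hq)
    (σ := σ)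
  simp only [ncsdLe, mem_NCSDSet_iff hp hq, permLe_iff_absLe, Set.mem_ofPred_eq, coe_image,
    Set.mem_image, mem_coe, mem_absIcc, Prod.mk.injEq]
  cases t
  · simp
    tauto
  · simp

/-- The element of the self-dual poset sent by the Kreweras complement to the permutation `x`,
where all disc-noncrossing permutations are taken unhatted. -/
noncomputable def krewerasInv (p q : ℕ) (x : Perm (Fin (p + q))) : Perm (Fin (p + q)) × Bool :=
  (tauPQ p q * x⁻¹, decide (PreservesSides (leftSide p q) x))

theorem krewerasInv_injective : Function.Injective (krewerasInv p q) := by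
  intro x y h
  simpa [krewerasInv] using congrArg Prod.fst h

theorem krewerasInv_mem (hp : 1 ≤ p) (hq : 1 ≤ q) {x : Perm (Fin (p + q))}
    (hx : TwoSidedNC (leftSide p q) (tauPQ p q) x) : krewerasInv p q x ∈ NCSDSet p q := by
  have hτ := preservesSides_of_sides (sameCycle_tauPQ p q)
  rw [mem_NCSDSet_iff hp hq]
  refine ⟨(twoSidedNC_kreweras_iff hτ).2 hx, fun h => (preservesSides_kreweras_iff hτ).2 ?_⟩
  simpa [krewerasInv] using h

theorem krewerasInv_kreweras (σ : Perm (Fin (p + q))) (t : Bool)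
    (h : t = true ↔ PreservesSides (leftSide p q) σ) :
    krewerasInv p q (σ⁻¹ * tauPQ p q) = (σ, t) := by
  have hτ := preservesSides_of_sides (sameCycle_tauPQ p q)
  have h' : PreservesSides (leftSide p q) (σ⁻¹ * tauPQ p q) ↔ PreservesSides (leftSide p q) σ := by
    rw [preservesSides_mul_iff' hτ, preservesSides_inv_iff]
  refine Prod.ext (by simp [krewerasInv]) ?_
  rw [Bool.eq_iff_iff, h, ← h']
  simp [krewerasInv]

theorem ncsdLe_krewerasInv_iff {x y : Perm (Fin (p + q))}
    (hx : TwoSidedNC (leftSide p q) (tauPQ p q) x)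
    (hy : TwoSidedNC (leftSide p q) (tauPQ p q) y) :
    ncsdLe p q (krewerasInv p q x) (krewerasInv p q y) ↔ AbsLe y x := by
  have e : ∀ z : Perm (Fin (p + q)), (tauPQ p q * z⁻¹)⁻¹ * tauPQ p q = z := fun z => by group
  simp only [ncsdLe, krewerasInv, permLe_iff_absLe, e, decide_eq_false_iff_not, decide_eq_true_iff]
  constructor
  · rintro (⟨hx', hy', h⟩ | h)
    · refine (absLe_kreweras_iff ?_).1 h
      rw [hx.resolve_left (fun h => hx' h.1) |>.2, hy.resolve_left (fun h => hy' h.1) |>.2]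
    · exact h.2
  · intro h
    by_cases hy' : PreservesSides (leftSide p q) y
    · exact Or.inr ⟨hy', h⟩
    · have hx' : ¬ PreservesSides (leftSide p q) x := fun h' => hy' (h'.of_absLe h)
      refine Or.inl ⟨hx', hy', (absLe_kreweras_iff ?_).2 h⟩
      rw [hx.resolve_left (fun h => hx' h.1) |>.2, hy.resolve_left (fun h => hy' h.1) |>.2]

theorem interval_krewerasInv (hp : 1 ≤ p) (hq : 1 ≤ q) {x y : Perm (Fin (p + q))}
    (hx : TwoSidedNC (leftSide p q) (tauPQ p q) x)
    (hy : TwoSidedNC (leftSide p q) (tauPQ p q) y) :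
    {c | c ∈ NCSDSet p q ∧ ncsdLe p q (krewerasInv p q x) c ∧ ncsdLe p q c (krewerasInv p q y)} =
      ((absIcc y x).image (krewerasInv p q) : Finset _) := by
  have hτ := preservesSides_of_sides (sameCycle_tauPQ p q)
  ext ⟨σ, t⟩
  simp only [Set.mem_ofPred_eq, coe_image, Set.mem_image, mem_coe, mem_absIcc]
  constructor
  · rintro ⟨hmem, hxc, hcy⟩
    have hc := (mem_NCSDSet_iff hp hq).1 hmem
    have ht : t = true ↔ PreservesSides (leftSide p q) σ := by
      refine ⟨hc.2, fun hσ => ?_⟩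
      by_contra hcon
      obtain ⟨h1, -, h2⟩ := hxc.resolve_right fun h => hcon h.1
      rw [permLe_iff_absLe] at h2
      have := hσ.of_absLe h2
      simp only [krewerasInv, decide_eq_false_iff_not] at h1
      exact h1 ((preservesSides_kreweras_iff hτ).1 this)
    have hK : TwoSidedNC (leftSide p q) (tauPQ p q) (σ⁻¹ * tauPQ p q) := by
      rw [← twoSidedNC_kreweras_iff hτ]
      simpa using hc.1
    rw [← krewerasInv_kreweras σ t ht] at hxc hcy
    rw [ncsdLe_krewerasInv_iff hx hK] at hxc
    rw [ncsdLe_krewerasInv_iff hK hy] at hcy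
    exact ⟨_, ⟨hcy, hxc⟩, krewerasInv_kreweras σ t ht⟩
  · rintro ⟨z, ⟨hyz, hzx⟩, hz⟩
    have hz' := hx.of_absLe (sameCycle_tauPQ p q) (exists_leftSide hp) (exists_not_leftSide hq) hzx
    rw [← hz]
    exact ⟨krewerasInv_mem hp hq hz', (ncsdLe_krewerasInv_iff hx hz').2 hzx,
      (ncsdLe_krewerasInv_iff hz' hy).2 hyz⟩

end Poset

end AnnNC

open AnnNC in
/-- the Möbius function of `S_nc-sd(p,q)` (characterised by its defining
summation identities) on a pair `π ⪯ ρ`, except when `π` is in the unhatted disc copy and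
`ρ` in the hatted copy, is `∏_{U ∈ Π(π′⁻¹ρ′)} (−1)^{|U|−1} C_{|U|−1}` where `π′, ρ′` are
the underlying permutations. -/
theorem stmt8 (p q : ℕ) (hp : 1 ≤ p) (hq : 1 ≤ q)
    (μ : (Equiv.Perm (Fin (p + q)) × Bool) → (Equiv.Perm (Fin (p + q)) × Bool) → ℤ)
    (hμ0 : ∀ a b, ¬ ncsdLe p q a b → μ a b = 0)
    (hμ1 : ∀ a ∈ NCSDSet p q, ∀ b ∈ NCSDSet p q, ncsdLe p q a b →
      (∑ᶠ c ∈ {c | c ∈ NCSDSet p q ∧ ncsdLe p q a c ∧ ncsdLe p q c b}, μ a c) =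
        if a = b then 1 else 0)
    (hμ2 : ∀ a ∈ NCSDSet p q, ∀ b ∈ NCSDSet p q, ncsdLe p q a b →
      (∑ᶠ c ∈ {c | c ∈ NCSDSet p q ∧ ncsdLe p q a c ∧ ncsdLe p q c b}, μ c b) =
        if a = b then 1 else 0) :
    ∀ a ∈ NCSDSet p q, ∀ b ∈ NCSDSet p q, ncsdLe p q a b →
      ¬ (a.2 = false ∧ a.1 ∈ SDiscNC p q ∧ b.2 = true) →
      μ a b = catProd (a.1⁻¹ * b.1) := by
  intro a ha b hb hab hne
  have hdown : ∀ ρ σ, TwoSidedNC (leftSide p q) (tauPQ p q) ρ → AbsLe σ ρ →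
      TwoSidedNC (leftSide p q) (tauPQ p q) σ := fun ρ σ hρ h =>
    hρ.of_absLe (sameCycle_tauPQ p q) (exists_leftSide hp) (exists_not_leftSide hq) h
  have hτ := preservesSides_of_sides (sameCycle_tauPQ p q)
  have hkr : ∀ σ : Equiv.Perm (Fin (p + q)), TwoSidedNC (leftSide p q) (tauPQ p q) σ →
      TwoSidedNC (leftSide p q) (tauPQ p q) (σ⁻¹ * tauPQ p q) := fun σ hσ => by
    rw [← twoSidedNC_kreweras_iff hτ]
    simpa using hσ
  have ha' := (mem_NCSDSet_iff hp hq).1 ha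
  have hb' := (mem_NCSDSet_iff hp hq).1 hb
  obtain ⟨π, s⟩ := a
  obtain ⟨ρ, t⟩ := b
  cases t
  · obtain ⟨hs, -, hle⟩ := hab.resolve_right fun h => by simp at h
    obtain rfl : s = false := hs
    rw [permLe_iff_absLe] at hle
    refine eq_catProd_of_sum_absIcc _ hdown π (fun σ => μ (π, false) (σ, false)) ?_ ρ hb'.1 hle
    intro σ hσ hπσ
    have := hμ1 (π, false) ha (σ, false) ((mem_NCSDSet_iff hp hq).2 ⟨hσ, by simp⟩)
      (Or.inl ⟨rfl, rfl, permLe_iff_absLe.2 hπσ⟩)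
    rw [interval_unhatted hp hq hσ, finsum_mem_coe_finset,
      Finset.sum_image (fun _ _ _ _ h => congrArg Prod.fst h)] at this
    rw [this]
    simp
  · have hle := (hab.resolve_left fun h => by simp at h).2
    rw [permLe_iff_absLe] at hle
    have hs : s = true ↔ PreservesSides (leftSide p q) π := by
      refine ⟨ha'.2, fun h => ?_⟩
      by_contra hcon
      exact hne ⟨by simpa using hcon, (mem_SDiscNC_iff hp hq).2 ⟨ha'.1, h⟩, rfl⟩
    have hρ : krewerasInv p q (ρ⁻¹ * tauPQ p q) = (ρ, true) :=
      krewerasInv_kreweras ρ true ⟨hb'.2, fun _ => rfl⟩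
    have key := eq_catProd_of_sum_absIcc _ hdown (ρ⁻¹ * tauPQ p q)
      (fun x => μ (krewerasInv p q x) (krewerasInv p q (ρ⁻¹ * tauPQ p q))) ?_
      (π⁻¹ * tauPQ p q) (hkr π ha'.1) hle
    · simp only [krewerasInv_kreweras π s hs, hρ] at key
      rw [key, catProd_mul_comm]
      congr 1
      group
    · intro x hx hyx
      have hy := hkr ρ hb'.1
      have := hμ2 _ (krewerasInv_mem hp hq hx) _ (krewerasInv_mem hp hq hy)
        ((ncsdLe_krewerasInv_iff hx hy).2 hyx)
      rw [interval_krewerasInv hp hq hx hy, finsum_mem_coe_finset,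
        Finset.sum_image krewerasInv_injective.injOn] at this
      rw [this]
      simp only [krewerasInv_injective.eq_iff, eq_comm]
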